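/- Let P be a FASP program and let LF(P) be the set of loop formulas of all loops of P. Then an interpretation I of P is an answer set of P if and only if I is a model of comp(P) ∪ LF(P). -/

import Mathlib

/-- A t-norm on `[0,1]`: an increasing (in each argument), commutative and associative
binary operator on `[0,1]` with neutral element `1`. -/
structure Tnorm where
  T : ℝ → ℝ → ℝ
  mem_Icc : ∀ x ∈ Set.Icc (0:ℝ) 1, ∀ y ∈ Set.Icc (0:ℝ) 1, T x y ∈ Set.Icc (0:ℝ) 1
  mono : ∀ x ∈ Set.Icc (0:ℝ) 1, ∀ x' ∈ Set.Icc (0:ℝ) 1, ∀ y ∈ Set.Icc (0:ℝ) 1,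
    ∀ y' ∈ Set.Icc (0:ℝ) 1, x ≤ x' → y ≤ y' → T x y ≤ T x' y'
  comm : ∀ x ∈ Set.Icc (0:ℝ) 1, ∀ y ∈ Set.Icc (0:ℝ) 1, T x y = T y x
  assoc : ∀ x ∈ Set.Icc (0:ℝ) 1, ∀ y ∈ Set.Icc (0:ℝ) 1, ∀ z ∈ Set.Icc (0:ℝ) 1,
    T (T x y) z = T x (T y z)
  one_T : ∀ x ∈ Set.Icc (0:ℝ) 1, T 1 x = x

/-- Left continuity of a t-norm in each argument (on `[0,1]`). -/
def Tnorm.LeftContinuous (Tn : Tnorm) : Prop :=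
  ∀ x ∈ Set.Icc (0:ℝ) 1, ∀ y ∈ Set.Icc (0:ℝ) 1,
    ContinuousWithinAt (fun t => Tn.T x t) (Set.Icc (0:ℝ) y) y ∧
    ContinuousWithinAt (fun t => Tn.T t y) (Set.Icc (0:ℝ) x) x

/-- The residual implicator of a t-norm: `I_T(x,y) = sup { λ ∈ [0,1] | T(x,λ) ≤ y }`. -/
noncomputable def Tnorm.resid (Tn : Tnorm) (x y : ℝ) : ℝ :=
  sSup { l | l ∈ Set.Icc (0:ℝ) 1 ∧ Tn.T x l ≤ y }

/-- The n-ary extension of a t-norm: `T(b) = b`, `T(b₁,…,bₙ) = T(b₁, T(b₂,…,bₙ))`. -/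
def Tnorm.listEval (Tn : Tnorm) : List ℝ → ℝ
  | [] => 1
  | [x] => x
  | x :: xs => Tn.T x (Tn.listEval xs)

/-- A negator: a decreasing `[0,1] → [0,1]` map with `N(0) = 1` and `N(1) = 0`. -/
structure Negator where
  N : ℝ → ℝ
  mem_Icc : ∀ x ∈ Set.Icc (0:ℝ) 1, N x ∈ Set.Icc (0:ℝ) 1
  anti : ∀ x ∈ Set.Icc (0:ℝ) 1, ∀ y ∈ Set.Icc (0:ℝ) 1, x ≤ y → N y ≤ N x
  N_zero : N 0 = 1
  N_one : N 1 = 0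

/-- A body element of a FASP rule: an atom, a constant from `[0,1]`, or a negated atom. -/
inductive Lit (α : Type*) where
  | pos : α → Lit α
  | const : ℝ → Lit α
  | neg : Negator → α → Lit α

/-- A FASP rule `a ← T(b₁,…,bₙ)`: a head (an atom or a constant in `[0,1]`), a body
(a list of extended literals, combined by the rule's t-norm). -/
structure Rule (α : Type*) where
  head : α ⊕ ℝ
  body : List (Lit α)
  tnorm : Tnorm

/-- Well-formedness of a literal: constants must lie in `[0,1]`. -/
def Lit.WF {α : Type*} : Lit α → Prop
  | .const c => c ∈ Set.Icc (0:ℝ) 1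
  | _ => True

/-- Well-formedness of a rule: nonempty body, constants in `[0,1]`, and a
left-continuous t-norm. -/
def Rule.WF {α : Type*} (r : Rule α) : Prop :=
  r.body ≠ [] ∧ (∀ l ∈ r.body, l.WF) ∧ r.tnorm.LeftContinuous ∧
    ∀ c : ℝ, r.head = Sum.inr c → c ∈ Set.Icc (0:ℝ) 1

/-- Well-formedness of a FASP program (a set of rules). -/
def ProgramWF {α : Type*} (P : Set (Rule α)) : Prop := ∀ r ∈ P, r.WF

/-- An interpretation maps every atom to a value in `[0,1]`. -/
def IsInterp {α : Type*} (I : α → ℝ) : Prop := ∀ a, I a ∈ Set.Icc (0:ℝ) 1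

/-- Evaluation of an extended literal: `I(c) = c`, `I(N(b)) = N(I(b))`. -/
def Lit.eval {α : Type*} (I : α → ℝ) : Lit α → ℝ
  | .pos a => I a
  | .const c => c
  | .neg n a => n.N (I a)

/-- Evaluation of a rule body: `I(body(r)) = T_r(I(b₁),…,I(bₙ))`. -/
def Rule.evalBody {α : Type*} (I : α → ℝ) (r : Rule α) : ℝ :=
  r.tnorm.listEval (r.body.map (Lit.eval I))

/-- Evaluation of a rule head. -/
def evalHead {α : Type*} (I : α → ℝ) : α ⊕ ℝ → ℝ
  | .inl a => I a
  | .inr c => c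

/-- The atoms occurring positively (non-negated) in the body of a rule. -/
def Rule.posbody {α : Type*} (r : Rule α) : Set α := { a | Lit.pos a ∈ r.body }

/-- The immediate consequence operator:
`Π_P(I)(a) = sup { I(body(r)) | r ∈ P_a }` (with `sup ∅ = 0`). -/
noncomputable def PiOp {α : Type*} (P : Set (Rule α)) (I : α → ℝ) : α → ℝ :=
  fun a => sSup { x | ∃ r ∈ P, r.head = Sum.inl a ∧ x = r.evalBody I }

/-- `I` is a model of `P` iff `I(r) = I_r(I(body(r)), I(head(r))) = 1` for all `r ∈ P`. -/
def IsModel {α : Type*} (P : Set (Rule α)) (I : α → ℝ) : Prop :=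
  ∀ r ∈ P, r.tnorm.resid (r.evalBody I) (evalHead I r.head) = 1

/-- The support of an interpretation: `supp(I) = { a | I(a) > 0 }`. -/
def supp {α : Type*} (I : α → ℝ) : Set α := { a | 0 < I a }

/-- `U` is unfounded w.r.t. `I`: for each `u ∈ U` and rule `r ∈ P_u`, either
`U ∩ posbody(r) ≠ ∅`, or `I(u) > I(body(r))`, or `I(body(r)) = 0`. -/
def Unfounded {α : Type*} (P : Set (Rule α)) (I : α → ℝ) (U : Set α) : Prop :=
  ∀ u ∈ U, ∀ r ∈ P, r.head = Sum.inl u →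
    (U ∩ r.posbody).Nonempty ∨ r.evalBody I < I u ∨ r.evalBody I = 0

/-- `I` is unfounded-free iff `supp(I) ∩ U = ∅` for every unfounded set `U`. -/
def UnfoundedFree {α : Type*} (P : Set (Rule α)) (I : α → ℝ) : Prop :=
  ∀ U : Set α, Unfounded P I U → supp I ∩ U = ∅

/-- An answer set of `P` is an unfounded-free model of `P`. -/
def IsAnswerSet {α : Type*} (P : Set (Rule α)) (I : α → ℝ) : Prop :=
  IsModel P I ∧ UnfoundedFree P I

/-- The reduct of a literal w.r.t. `I`: every negated atom `N(b)` is replaced by the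
constant `N(I(b))`. -/
def Lit.reduct {α : Type*} (I : α → ℝ) : Lit α → Lit α
  | .neg n a => .const (n.N (I a))
  | l => l

/-- The reduct of a rule w.r.t. `I`. -/
def Rule.reduct {α : Type*} (I : α → ℝ) (r : Rule α) : Rule α :=
  ⟨r.head, r.body.map (Lit.reduct I), r.tnorm⟩

/-- The reduct of a program: `P^I = { r^I | r ∈ P }`. -/
def reduct {α : Type*} (P : Set (Rule α)) (I : α → ℝ) : Set (Rule α) :=
  (Rule.reduct I) '' P

/-- `F` is the least fixpoint of `Π_P` (among interpretations). -/
def IsLfp {α : Type*} (P : Set (Rule α)) (F : α → ℝ) : Prop :=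
  IsInterp F ∧ PiOp P F = F ∧
    ∀ G : α → ℝ, IsInterp G → PiOp P G = G → ∀ a, F a ≤ G a

/-- `I` is a model of the completion `comp(P)`: for every atom `a`,
`I(a) = sup { I(body(r)) | r ∈ P_a }` (with `sup ∅ = 0`), and for every rule with a
constant head `c`, `I(body(r)) ≤ c`. -/
def ModelsComp {α : Type*} (P : Set (Rule α)) (I : α → ℝ) : Prop :=
  (∀ a, I a = sSup { x | ∃ r ∈ P, r.head = Sum.inl a ∧ x = r.evalBody I }) ∧
  (∀ r ∈ P, ∀ c : ℝ, r.head = Sum.inr c → r.evalBody I ≤ c)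

/-- Edge of the positive dependency graph of `P`: `(a,b)` iff some rule with head `a`
has `b` occurring positively in its body. -/
def depEdge {α : Type*} (P : Set (Rule α)) (a b : α) : Prop :=
  ∃ r ∈ P, r.head = Sum.inl a ∧ b ∈ r.posbody

/-- A loop of `P`: a nonempty set `L` of atoms such that any two elements of `L` are
joined by a path of positive length in the positive dependency graph all of whose
vertices lie in `L`. -/
def IsLoop {α : Type*} (P : Set (Rule α)) (L : Set α) : Prop :=
  L.Nonempty ∧ ∀ a ∈ L, ∀ b ∈ L,
    Relation.TransGen (fun u v => depEdge P u v ∧ u ∈ L ∧ v ∈ L) a b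

/-- `R⁻(P,L)`: the rules of `P` with head in `L` whose positive body is disjoint
from `L`. -/
def extRules {α : Type*} (P : Set (Rule α)) (L : Set α) : Set (Rule α) :=
  { r | r ∈ P ∧ (∃ a ∈ L, r.head = Sum.inl a) ∧ r.posbody ∩ L = ∅ }

/-- `I` satisfies the loop formula `LF(L,P)` iff
`max { I(l) | l ∈ L } ≤ max { I(body(r)) | r ∈ R⁻(P,L) }` (right-hand side `0` when
`R⁻(P,L) = ∅`). -/
def SatLF {α : Type*} (P : Set (Rule α)) (L : Set α) (I : α → ℝ) : Prop :=
  sSup (I '' L) ≤ sSup { x | ∃ r ∈ extRules P L, x = r.evalBody I }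

/-- A simple program: no rule body contains a negated atom. -/
def Simple {α : Type*} (P : Set (Rule α)) : Prop :=
  ∀ r ∈ P, ∀ l ∈ r.body, ∀ (n : Negator) (a : α), l ≠ Lit.neg n a

namespace Tnorm

theorem T_le_right (Tn : Tnorm) {x y : ℝ} (hx : x ∈ Set.Icc (0:ℝ) 1)
    (hy : y ∈ Set.Icc (0:ℝ) 1) : Tn.T x y ≤ y :=
  (Tn.mono x hx 1 (by simp) y hy y hy hx.2 le_rfl).trans_eq (Tn.one_T y hy)

theorem T_one (Tn : Tnorm) {x : ℝ} (hx : x ∈ Set.Icc (0:ℝ) 1) : Tn.T x 1 = x :=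
  (Tn.comm x hx 1 (by simp)).trans (Tn.one_T x hx)

theorem T_le_left (Tn : Tnorm) {x y : ℝ} (hx : x ∈ Set.Icc (0:ℝ) 1)
    (hy : y ∈ Set.Icc (0:ℝ) 1) : Tn.T x y ≤ x :=
  (Tn.comm x hx y hy).trans_le (Tn.T_le_right hy hx)

theorem listEval_mem_Icc (Tn : Tnorm) {l : List ℝ} (h : ∀ x ∈ l, x ∈ Set.Icc (0:ℝ) 1) :
    Tn.listEval l ∈ Set.Icc (0:ℝ) 1 := by
  induction l with
  | nil => simp [listEval]
  | cons x xs ih =>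
    cases xs with
    | nil => exact h x (by simp)
    | cons y ys =>
      exact Tn.mem_Icc _ (h x (by simp)) _ (ih fun z hz => h z (List.mem_cons_of_mem _ hz))

theorem listEval_le_of_mem (Tn : Tnorm) {l : List ℝ} (h : ∀ x ∈ l, x ∈ Set.Icc (0:ℝ) 1)
    {b : ℝ} (hb : b ∈ l) : Tn.listEval l ≤ b := by
  induction l with
  | nil => simp at hb
  | cons x xs ih =>
    cases xs with
    | nil =>
      rw [List.mem_singleton.1 hb]
      exact le_rfl
    | cons y ys =>
      have hx := h x (by simp)
      have hxs : ∀ z ∈ y :: ys, z ∈ Set.Icc (0:ℝ) 1 := fun z hz =>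
        h z (List.mem_cons_of_mem _ hz)
      rcases List.mem_cons.1 hb with rfl | hb
      · exact Tn.T_le_left hx (Tn.listEval_mem_Icc hxs)
      · exact (Tn.T_le_right hx (Tn.listEval_mem_Icc hxs)).trans (ih hxs hb)

/-- For a left-continuous t-norm, the residual implicator takes the value `1` exactly when its
first argument is at most its second. -/
theorem resid_eq_one_iff (Tn : Tnorm) (hT : Tn.LeftContinuous) {x y : ℝ}
    (hx : x ∈ Set.Icc (0:ℝ) 1) : Tn.resid x y = 1 ↔ x ≤ y := by
  have hbdd : BddAbove {l | l ∈ Set.Icc (0:ℝ) 1 ∧ Tn.T x l ≤ y} := ⟨1, fun l hl => hl.1.2⟩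
  constructor
  · intro h
    have hne : {l | l ∈ Set.Icc (0:ℝ) 1 ∧ Tn.T x l ≤ y}.Nonempty := by
      by_contra hne
      rw [Set.not_nonempty_iff_eq_empty] at hne
      rw [resid, hne, Real.sSup_empty] at h
      exact zero_ne_one h
    have hcl := csSup_mem_closure hne hbdd
    change Tn.resid x y ∈ _ at hcl
    rw [h] at hcl
    have hc := ((hT x hx 1 (by simp)).1.mono fun l (hl : l ∈ {l | l ∈ Set.Icc (0:ℝ) 1 ∧
      Tn.T x l ≤ y}) => hl.1).mem_closure_image hcl
    have : Tn.T x 1 ∈ Set.Iic y := closure_minimal (by rintro _ ⟨l, hl, rfl⟩; exact hl.2)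
      isClosed_Iic hc
    rwa [Tn.T_one hx] at this
  · intro h
    exact le_antisymm (Real.sSup_le (fun l hl => hl.1.2) zero_le_one)
      (le_csSup hbdd ⟨by simp, (Tn.T_one hx).trans_le h⟩)

end Tnorm

section Program

variable {α : Type*} {P : Set (Rule α)} {I : α → ℝ}

theorem Lit.eval_mem_Icc (hI : IsInterp I) {l : Lit α} (hl : l.WF) :
    l.eval I ∈ Set.Icc (0:ℝ) 1 := by
  cases l with
  | pos a => exact hI a
  | const c => exact hl
  | neg n a => exact n.mem_Icc _ (hI a)

theorem Rule.WF.eval_mem_Icc {r : Rule α} (hr : r.WF) (hI : IsInterp I) :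
    ∀ x ∈ r.body.map (Lit.eval I), x ∈ Set.Icc (0:ℝ) 1 := by
  intro x hx
  obtain ⟨l, hl, rfl⟩ := List.mem_map.1 hx
  exact Lit.eval_mem_Icc hI (hr.2.1 l hl)

theorem Rule.WF.evalBody_mem_Icc {r : Rule α} (hr : r.WF) (hI : IsInterp I) :
    r.evalBody I ∈ Set.Icc (0:ℝ) 1 :=
  r.tnorm.listEval_mem_Icc (hr.eval_mem_Icc hI)

theorem Rule.WF.evalBody_le {r : Rule α} (hr : r.WF) (hI : IsInterp I) {b : α}
    (hb : b ∈ r.posbody) : r.evalBody I ≤ I b :=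
  r.tnorm.listEval_le_of_mem (hr.eval_mem_Icc hI) (List.mem_map.2 ⟨_, hb, rfl⟩)

theorem isModel_iff (hwf : ProgramWF P) (hI : IsInterp I) :
    IsModel P I ↔ ∀ r ∈ P, r.evalBody I ≤ evalHead I r.head :=
  forall₂_congr fun r hr =>
    r.tnorm.resid_eq_one_iff (hwf r hr).2.2.1 ((hwf r hr).evalBody_mem_Icc hI)

theorem ModelsComp.isModel (hfin : P.Finite) (hwf : ProgramWF P) (hI : IsInterp I)
    (h : ModelsComp P I) : IsModel P I := by
  refine (isModel_iff hwf hI).2 fun r hr => ?_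
  rcases hd : r.head with a | c
  · rw [evalHead, h.1 a]
    refine le_csSup ?_ ⟨r, hr, hd, rfl⟩
    exact ((hfin.image (Rule.evalBody I)).subset
      (by rintro _ ⟨r, hr, -, rfl⟩; exact ⟨r, hr, rfl⟩)).bddAbove
  · exact h.2 r hr c hd

theorem IsAnswerSet.modelsComp (hwf : ProgramWF P) (hI : IsInterp I) (h : IsAnswerSet P I) :
    ModelsComp P I := by
  have hm := (isModel_iff hwf hI).1 h.1
  have hle : ∀ a, ∀ r ∈ P, r.head = Sum.inl a → r.evalBody I ≤ I a := fun a r hr hd => by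
    simpa [hd, evalHead] using hm r hr
  refine ⟨fun a => le_antisymm ?_ ?_, fun r hr c hd => by simpa [hd, evalHead] using hm r hr⟩
  · by_contra! hlt
    have hbdd : BddAbove {x | ∃ r ∈ P, r.head = Sum.inl a ∧ x = r.evalBody I} :=
      ⟨I a, by rintro _ ⟨r, hr, hd, rfl⟩; exact hle a r hr hd⟩
    have hpos : 0 < I a := (Real.sSup_nonneg (by
      rintro _ ⟨r, hr, -, rfl⟩; exact ((hwf r hr).evalBody_mem_Icc hI).1)).trans_lt hlt
    have hU : Unfounded P I {a} := by
      rintro _ rfl r hr hd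
      exact Or.inr (Or.inl ((le_csSup hbdd ⟨r, hr, hd, rfl⟩).trans_lt hlt))
    exact (h.2 _ hU).subset ⟨hpos, rfl⟩
  · exact Real.sSup_le (by rintro _ ⟨r, hr, hd, rfl⟩; exact hle a r hr hd) (hI a).1

/-- An unfounded-free interpretation satisfies the loop formula of every set of atoms. -/
theorem UnfoundedFree.satLF (hwf : ProgramWF P) (hI : IsInterp I) (h : UnfoundedFree P I)
    (L : Set α) : SatLF P L I := by
  set M := sSup {x | ∃ r ∈ extRules P L, x = r.evalBody I} with hM
  have hbdd : BddAbove {x | ∃ r ∈ extRules P L, x = r.evalBody I} :=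
    ⟨1, by rintro _ ⟨r, hr, rfl⟩; exact ((hwf r hr.1).evalBody_mem_Icc hI).2⟩
  have hM0 : 0 ≤ M := Real.sSup_nonneg (by
    rintro _ ⟨r, hr, rfl⟩; exact ((hwf r hr.1).evalBody_mem_Icc hI).1)
  have hU : Unfounded P I {u ∈ L | M < I u} := by
    rintro u ⟨huL, hu⟩ r hr hd
    rcases (r.posbody ∩ L).eq_empty_or_nonempty with he | ⟨b, hb, hbL⟩
    · exact Or.inr (Or.inl ((le_csSup hbdd ⟨r, ⟨hr, ⟨u, huL, hd⟩, he⟩, rfl⟩).trans_lt hu))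
    · rcases lt_or_ge M (I b) with hlt | hge
      · exact Or.inl ⟨b, ⟨hbL, hlt⟩, hb⟩
      · exact Or.inr (Or.inl ((((hwf r hr).evalBody_le hI hb).trans hge).trans_lt hu))
  refine Real.sSup_le ?_ hM0
  rintro _ ⟨u, hu, rfl⟩
  by_contra! hlt
  exact (h _ hU).subset ⟨hM0.trans_lt hlt, hu, hlt⟩

/-- A nonempty finite set of atoms in which every atom has a successor contains a loop that is
closed under successors in the set. -/
theorem exists_isLoop_closed [Finite α] {U : Set α} (hne : U.Nonempty)
    (hU : ∀ u ∈ U, ∃ v ∈ U, depEdge P u v) :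
    ∃ L ⊆ U, IsLoop P L ∧ ∀ a ∈ L, ∀ b ∈ U, depEdge P a b → b ∈ L := by
  let R : α → α → Prop := fun u v => depEdge P u v ∧ u ∈ U ∧ v ∈ U
  let reach : α → Set α := fun u => {v | Relation.TransGen R u v}
  have hsub : ∀ u, reach u ⊆ U := fun u v hv => by
    obtain ⟨w, -, hw⟩ := Relation.TransGen.tail'_iff.1 hv
    exact hw.2.2
  obtain ⟨u, hu, hmin⟩ := Set.exists_min_image U (fun u => (reach u).ncard) (Set.toFinite U) hne
  have hreach : ∀ v ∈ reach u, reach v = reach u := fun v hv =>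
    Set.eq_of_subset_of_ncard_le (fun w hw => Relation.TransGen.trans hv hw)
      (hmin v (hsub u hv))
  refine ⟨reach u, hsub u, ⟨?_, fun a ha b hb => ?_⟩, fun a ha b hb hab => ?_⟩
  · obtain ⟨v, hv, huv⟩ := hU u hu
    exact ⟨v, .single ⟨huv, hu, hv⟩⟩
  · rw [← hreach a ha] at hb
    induction hb with
    | single h => exact .single ⟨h.1, ha, .tail ha h⟩
    | tail h hbc ih => exact ih.tail ⟨hbc.1, .trans ha h, (Relation.TransGen.trans ha h).tail hbc⟩
  · exact Relation.TransGen.tail ha ⟨hab, hsub u ha, hb⟩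

theorem ModelsComp.unfoundedFree [Finite α] (hfin : P.Finite) (hwf : ProgramWF P)
    (hI : IsInterp I) (h : ModelsComp P I) (hLF : ∀ L : Set α, IsLoop P L → SatLF P L I) :
    UnfoundedFree P I := by
  intro U hU
  by_contra hne
  have hfinite : ∀ S : Set ℝ, (∀ x ∈ S, ∃ r ∈ P, x = r.evalBody I) → S.Finite := fun S hS =>
    (hfin.image (Rule.evalBody I)).subset fun x hx => by
      obtain ⟨r, hr, rfl⟩ := hS x hx
      exact ⟨r, hr, rfl⟩
  have hsupport : ∀ a ∈ supp I ∩ U, ∀ r ∈ P, r.head = Sum.inl a → I a ≤ r.evalBody I →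
      ∃ b ∈ supp I ∩ U, b ∈ r.posbody := by
    rintro a ⟨hpos, haU⟩ r hr hd hle
    have hbody : 0 < r.evalBody I := lt_of_lt_of_le hpos hle
    rcases hU a haU r hr hd with ⟨b, hbU, hb⟩ | hlt | h0
    · exact ⟨b, ⟨hbody.trans_le ((hwf r hr).evalBody_le hI hb), hbU⟩, hb⟩
    · exact absurd hle hlt.not_ge
    · exact absurd h0 hbody.ne'
  have hsucc : ∀ u ∈ supp I ∩ U, ∃ v ∈ supp I ∩ U, depEdge P u v := by
    intro u hu
    have hupos : 0 < I u := hu.1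
    have hSne : {x | ∃ r ∈ P, r.head = Sum.inl u ∧ x = r.evalBody I}.Nonempty := by
      by_contra hS
      have := h.1 u
      rw [Set.not_nonempty_iff_eq_empty.1 hS, Real.sSup_empty] at this
      exact hupos.ne' this
    obtain ⟨r, hr, hd, hx⟩ := hSne.csSup_mem
      (hfinite _ (by rintro _ ⟨r, hr, -, rfl⟩; exact ⟨r, hr, rfl⟩))
    obtain ⟨b, hb, hbr⟩ := hsupport u hu r hr hd (((h.1 u).trans hx).le)
    exact ⟨b, hb, r, hr, hd, hbr⟩
  obtain ⟨L, hLU, hL, hclosed⟩ :=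
    exists_isLoop_closed (Set.nonempty_iff_ne_empty.2 hne) hsucc
  have hle : ∀ a ∈ L, I a ≤ sSup {x | ∃ r ∈ extRules P L, x = r.evalBody I} := fun a ha =>
    (le_csSup (Set.toFinite (I '' L)).bddAbove ⟨a, ha, rfl⟩).trans (hLF L hL)
  obtain ⟨a, ha⟩ := hL.1
  have hapos : 0 < I a := (hLU ha).1
  have hSne : {x | ∃ r ∈ extRules P L, x = r.evalBody I}.Nonempty := by
    by_contra hS
    have := hle a ha
    rw [Set.not_nonempty_iff_eq_empty.1 hS, Real.sSup_empty] at this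
    exact hapos.not_ge this
  obtain ⟨r, ⟨hr, ⟨c, hc, hd⟩, hdisj⟩, hx⟩ := hSne.csSup_mem
    (hfinite _ (by rintro _ ⟨r, hr, rfl⟩; exact ⟨r, hr.1, rfl⟩))
  obtain ⟨b, hb, hbr⟩ := hsupport c (hLU hc) r hr hd ((hle c hc).trans_eq hx)
  exact hdisj.subset ⟨hbr, hclosed c hc b hb ⟨r, hr, hd, hbr⟩⟩

end Program

/-- an interpretation `I` of `P` is an answer set of `P` iff `I` is a
model of `comp(P) ∪ LF(P)` (the completion together with the loop formulas of all
loops of `P`). -/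
theorem answerSet_iff_modelsComp_and_loopFormulas {α : Type*} [Finite α]
    (P : Set (Rule α)) (hfin : P.Finite) (hwf : ProgramWF P)
    (I : α → ℝ) (hI : IsInterp I) :
    IsAnswerSet P I ↔
      (ModelsComp P I ∧ ∀ L : Set α, IsLoop P L → SatLF P L I) := by
  constructor
  · exact fun h => ⟨h.modelsComp hwf hI, fun L _ => h.2.satLF hwf hI L⟩
  · exact fun ⟨hc, hLF⟩ => ⟨hc.isModel hfin hwf hI, hc.unfoundedFree hfin hwf hI hLF⟩
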